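/- Let q = p^k be a prime power with q ≡ 3 (mod 4), and let n be an integer with 1 ≤ n ≤ q−1. Then the map f(x) = x^n preserves positivity on M_2(F_q) if and only if n = p^i for some integer i with 0 ≤ i ≤ k−1. -/

import Mathlib

/-- An element of a field is *positive* if it is a nonzero square. -/
def IsPos {F : Type*} [Field F] (x : F) : Prop := ∃ y : F, y ≠ 0 ∧ y ^ 2 = x

/-- The `r`-th leading principal minor of a square matrix (the determinant of the
top-left `(r+1) × (r+1)` submatrix). -/
def leadingMinor {F : Type*} [CommRing F] {n : ℕ} (A : Matrix (Fin n) (Fin n) F)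
    (r : Fin n) : F :=
  (A.submatrix (Fin.castLE r.isLt) (Fin.castLE r.isLt)).det

/-- A matrix over a finite field is positive definite if it is symmetric and all its
leading principal minors are positive (nonzero squares). -/
def IsPosDef {F : Type*} [Field F] {n : ℕ} (A : Matrix (Fin n) (Fin n) F) : Prop :=
  A.IsSymm ∧ ∀ r : Fin n, IsPos (leadingMinor A r)

/-- The entrywise application `f[A]` of `f` to the matrix `A`. -/
def entrywiseMap {F : Type*} {n : ℕ} (f : F → F) (A : Matrix (Fin n) (Fin n) F) :
    Matrix (Fin n) (Fin n) F := Matrix.of fun i j => f (A i j)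

/-- `f` preserves positivity on `n × n` matrices. -/
def PreservesPos {F : Type*} [Field F] (n : ℕ) (f : F → F) : Prop :=
  ∀ A : Matrix (Fin n) (Fin n) F, IsPosDef A → IsPosDef (entrywiseMap f A)

theorem IsPos.ne_zero {F : Type*} [Field F] {x : F} (hx : IsPos x) : x ≠ 0 := by
  obtain ⟨y, hy, rfl⟩ := hx
  exact pow_ne_zero 2 hy

theorem isPos_one {F : Type*} [Field F] : IsPos (1 : F) := ⟨1, one_ne_zero, one_pow 2⟩

theorem IsPos.mul {F : Type*} [Field F] {x y : F} (hx : IsPos x) (hy : IsPos y) :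
    IsPos (x * y) := by
  obtain ⟨a, ha, rfl⟩ := hx
  obtain ⟨b, hb, rfl⟩ := hy
  exact ⟨a * b, mul_ne_zero ha hb, mul_pow a b 2⟩

theorem IsPos.inv {F : Type*} [Field F] {x : F} (hx : IsPos x) : IsPos x⁻¹ := by
  obtain ⟨a, ha, rfl⟩ := hx
  exact ⟨a⁻¹, inv_ne_zero ha, inv_pow a 2⟩

theorem IsPos.pow {F : Type*} [Field F] {x : F} (hx : IsPos x) (n : ℕ) : IsPos (x ^ n) := by
  obtain ⟨a, ha, rfl⟩ := hx
  exact ⟨a ^ n, pow_ne_zero n ha, pow_right_comm a n 2⟩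

/-- Positive definiteness of a `2 × 2` matrix, entry by entry. -/
theorem isPosDef_two_iff {F : Type*} [Field F] (A : Matrix (Fin 2) (Fin 2) F) :
    IsPosDef A ↔ A 1 0 = A 0 1 ∧ IsPos (A 0 0) ∧ IsPos (A 0 0 * A 1 1 - A 0 1 * A 1 0) := by
  have h0 : leadingMinor A 0 = A 0 0 := by
    unfold leadingMinor
    exact Matrix.det_fin_one _
  have h1 : leadingMinor A 1 = A 0 0 * A 1 1 - A 0 1 * A 1 0 := by
    unfold leadingMinor
    exact Matrix.det_fin_two _
  unfold IsPosDef
  rw [Fin.forall_fin_two, h0, h1, Matrix.IsSymm.ext_iff]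
  simp only [Fin.forall_fin_two]
  grind

/-- A monomial preserving positivity on `M_2` maps `1 + s`, with `s` positive, to an element
exceeding `1` by a positive one. -/
theorem PreservesPos.isPos_one_add_pow_sub_one {F : Type*} [Field F] {n : ℕ}
    (h : PreservesPos 2 (fun x : F => x ^ n)) {s : F} (hs : IsPos s) :
    IsPos ((1 + s) ^ n - 1) := by
  have := h !![1, 1; 1, 1 + s] ((isPosDef_two_iff _).2 (by simp [isPos_one, hs]))
  simpa [isPosDef_two_iff, entrywiseMap, isPos_one] using this

theorem isPos_pow_sub_one {F : Type*} [Field F] {n : ℕ}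
    (h : ∀ s : F, IsPos s → IsPos ((1 + s) ^ n - 1)) {x : F} (hx : IsPos (x - 1)) :
    IsPos (x ^ n - 1) := by
  simpa using h (x - 1) hx

theorem isPos_one_sub_pow {F : Type*} [Field F] {n : ℕ}
    (h : ∀ s : F, IsPos s → IsPos ((1 + s) ^ n - 1)) {x : F} (hx : IsPos x)
    (hx1 : IsPos (1 - x)) : IsPos (1 - x ^ n) := by
  have hx0 := hx.ne_zero
  have h1 : IsPos (x⁻¹ - 1) := by
    convert hx1.mul hx.inv using 1
    field_simp
  have h2 := (isPos_pow_sub_one h h1).mul (hx.pow n)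
  rwa [sub_mul, one_mul, ← mul_pow, inv_mul_cancel₀ hx0, one_pow] at h2

theorem preservesPos_two_pow_expChar_pow {F : Type*} [Field F] (p : ℕ) [ExpChar F p] (i : ℕ) :
    PreservesPos 2 (fun x : F => x ^ p ^ i) := by
  intro A hA
  rw [isPosDef_two_iff] at hA ⊢
  obtain ⟨h1, h2, h3⟩ := hA
  refine ⟨by simp [entrywiseMap, h1], h2.pow _, ?_⟩
  simpa [entrywiseMap, sub_pow_expChar_pow, mul_pow] using h3.pow (p ^ i)

section QuadraticCharacter

variable {F : Type*} [Field F] [Fintype F]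

theorem isPos_or_isPos_neg (hq : Fintype.card F % 4 = 3) {x : F} (hx : x ≠ 0) :
    IsPos x ∨ IsPos (-x) := by
  have hchar : ringChar F ≠ 2 := by
    intro h
    have := FiniteField.even_card_of_char_two h
    omega
  have key : ∀ z : F, z ≠ 0 → z ^ (Fintype.card F / 2) = 1 → IsPos z := by
    intro z hz h
    obtain ⟨r, hr⟩ := (FiniteField.isSquare_iff hchar hz).2 h
    refine ⟨r, ?_, by rw [hr, sq]⟩
    rintro rfl
    simp [hz] at hr
  rcases FiniteField.pow_dichotomy hchar hx with h | h
  · exact Or.inl (key x hx h)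
  · refine Or.inr (key (-x) (neg_ne_zero.2 hx) ?_)
    have hodd : Odd (Fintype.card F / 2) := Nat.odd_iff.2 (by omega)
    rw [hodd.neg_pow, h, neg_neg]

theorem IsPos.pow_card_div_two (hq : Fintype.card F % 4 = 3) {x : F} (hx : IsPos x) :
    x ^ (Fintype.card F / 2) = 1 := by
  obtain ⟨y, hy, rfl⟩ := hx
  rw [← pow_mul, show 2 * (Fintype.card F / 2) = Fintype.card F - 1 by omega]
  exact FiniteField.pow_card_sub_one_eq_one y hy

theorem pow_card_div_two_of_isPos_neg (hq : Fintype.card F % 4 = 3) {x : F} (hx : IsPos (-x)) :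
    x ^ (Fintype.card F / 2) = -1 := by
  have h := hx.pow_card_div_two hq
  have hodd : Odd (Fintype.card F / 2) := Nat.odd_iff.2 (by omega)
  rw [hodd.neg_pow] at h
  rw [← h, neg_neg]

theorem IsPos.not_isPos_neg (hq : Fintype.card F % 4 = 3) {x : F} (hx : IsPos x) :
    ¬ IsPos (-x) := by
  intro h
  have h1 := hx.pow_card_div_two hq
  rw [pow_card_div_two_of_isPos_neg hq h] at h1
  have hchar : ringChar F ≠ 2 := by
    intro h
    have := FiniteField.even_card_of_char_two h
    omega
  exact Ring.neg_one_ne_one_of_char_ne_two hchar h1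

theorem exists_isPos_isPos_neg_add_one (hq : Fintype.card F % 4 = 3) :
    ∃ y : F, IsPos y ∧ IsPos (-(y + 1)) := by
  by_contra! hcon
  have h1 : ∀ y : F, IsPos y → IsPos (y + 1) := by
    intro y hy
    rcases eq_or_ne (y + 1) 0 with h | h
    · rw [eq_neg_of_add_eq_zero_left h] at hy
      exact absurd hy (isPos_one.not_isPos_neg hq)
    · exact (isPos_or_isPos_neg hq h).resolve_right (hcon y hy)
  have h2 : ∀ r : ℕ, IsPos ((r : F) + 1) := by
    intro r
    induction r with
    | zero => simpa using isPos_one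
    | succ r ih => simpa using h1 _ ih
  have h3 := (h2 (Fintype.card F - 1)).ne_zero
  apply h3
  rw [← Nat.cast_add_one, Nat.sub_add_cancel Fintype.card_pos, Nat.cast_card_eq_zero]

theorem odd_of_isPos_one_add_pow_sub_one {n : ℕ} (hq : Fintype.card F % 4 = 3)
    (h : ∀ s : F, IsPos s → IsPos ((1 + s) ^ n - 1)) : Odd n := by
  rw [← Nat.not_even_iff_odd]
  intro hn
  obtain ⟨y, hy, hy1⟩ := exists_isPos_isPos_neg_add_one hq
  have key : ∀ y : F, IsPos y → IsPos (-(y + 1)) → IsPos (y - 1) := by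
    intro y hy hy1
    have h1 := h _ hy1
    rw [show 1 + -(y + 1) = -y by ring, hn.neg_pow] at h1
    rcases eq_or_ne y 1 with rfl | hne
    · simpa using h1.ne_zero
    refine (isPos_or_isPos_neg hq (sub_ne_zero.2 hne)).resolve_right fun h2 => ?_
    rw [neg_sub] at h2
    have h3 := isPos_one_sub_pow h hy h2
    rw [← neg_sub] at h3
    exact h1.not_isPos_neg hq h3
  have hy0 := hy.ne_zero
  have h1 := key y hy hy1
  have h2 := key y⁻¹ hy.inv (by
    convert hy1.mul hy.inv using 1
    field_simp
    ring)
  refine h1.not_isPos_neg hq ?_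
  convert h2.mul hy using 1
  field_simp
  ring

theorem eq_one_of_pow_eq_one_of_isPos {n : ℕ} (hq : Fintype.card F % 4 = 3)
    (h : ∀ s : F, IsPos s → IsPos ((1 + s) ^ n - 1)) {x : F} (hx : IsPos x)
    (hxn : x ^ n = 1) : x = 1 := by
  by_contra hne
  rcases isPos_or_isPos_neg hq (sub_ne_zero.2 hne) with h1 | h1
  · have := (isPos_pow_sub_one h h1).ne_zero
    simp [hxn] at this
  · rw [neg_sub] at h1
    have := (isPos_one_sub_pow h hx h1).ne_zero
    simp [hxn] at this

theorem coprime_card_sub_one {n : ℕ} (hq : Fintype.card F % 4 = 3)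
    (h : ∀ s : F, IsPos s → IsPos ((1 + s) ^ n - 1)) : n.Coprime (Fintype.card F - 1) := by
  classical
  have hodd := odd_of_isPos_one_add_pow_sub_one hq h
  refine Nat.coprime_of_dvd fun r hr hrn hrq => ?_
  have : Fact r.Prime := ⟨hr⟩
  obtain ⟨u, hu⟩ := exists_prime_orderOf_dvd_card (G := Fˣ) r (by rwa [Fintype.card_units])
  have hun : (u : F) ^ n = 1 := by
    have : u ^ n = 1 := orderOf_dvd_iff_pow_eq_one.1 (hu ▸ hrn)
    rw [← Units.val_pow_eq_pow_val, this, Units.val_one]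
  have hu1 : (u : F) = 1 := by
    rcases isPos_or_isPos_neg hq u.ne_zero with hp | hp
    · exact eq_one_of_pow_eq_one_of_isPos hq h hp hun
    · have h1 := hp.pow n
      rw [hodd.neg_pow, hun] at h1
      exact absurd h1 (isPos_one.not_isPos_neg hq)
  have : u = 1 := Units.ext hu1
  rw [this, orderOf_one] at hu
  exact hr.one_lt.ne hu

theorem isPos_neg_pow_add_one_iff {n : ℕ} (hq : Fintype.card F % 4 = 3)
    (h : ∀ s : F, IsPos s → IsPos ((1 + s) ^ n - 1)) {x : F} (hx : IsPos x) :
    IsPos (-(x ^ n + 1)) ↔ IsPos (-(x + 1)) := by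
  have hodd := odd_of_isPos_one_add_pow_sub_one hq h
  have step : ∀ y : F, IsPos (-(y + 1)) → IsPos (-(y ^ n + 1)) := by
    intro y hy
    have h1 := h _ hy
    rw [show 1 + -(y + 1) = -y by ring, hodd.neg_pow] at h1
    convert h1 using 1
    ring
  refine ⟨fun hxn => ?_, step x⟩
  have iter : ∀ r : ℕ, IsPos (-(x ^ n ^ (r + 1) + 1)) := by
    intro r
    induction r with
    | zero => simpa using hxn
    | succ r ih => rw [pow_succ n, pow_mul]; exact step _ ih
  have hcop := coprime_card_sub_one hq h
  have hpow := (Nat.ModEq.pow_totient hcop).symm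
  have hφ : 0 < Nat.totient (Fintype.card F - 1) := Nat.totient_pos.2 (by omega)
  obtain ⟨r, hr⟩ := Nat.exists_eq_succ_of_ne_zero hφ.ne'
  have h1 := iter r
  rw [← Nat.succ_eq_add_one, ← hr] at h1
  have hn1 : 1 ≤ n ^ Nat.totient (Fintype.card F - 1) := Nat.one_le_pow _ _ hodd.pos
  obtain ⟨c, hc⟩ := (Nat.modEq_iff_dvd' hn1).1 hpow
  rw [show n ^ Nat.totient (Fintype.card F - 1) = (Fintype.card F - 1) * c + 1 by omega,
    pow_succ, pow_mul, FiniteField.pow_card_sub_one_eq_one x hx.ne_zero, one_pow, one_mul] at h1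
  exact h1

/-- The monomial preserves the quadratic character of differences. -/
theorem pow_add_one_pow_card_div_two {n : ℕ} (hq : Fintype.card F % 4 = 3)
    (h : ∀ s : F, IsPos s → IsPos ((1 + s) ^ n - 1)) (x : F) :
    (x ^ n + 1) ^ (Fintype.card F / 2) = (x + 1) ^ (Fintype.card F / 2) := by
  have hodd := odd_of_isPos_one_add_pow_sub_one hq h
  rcases eq_or_ne x 0 with rfl | hx0
  · rw [zero_pow hodd.pos.ne']
  have hne : ∀ y : F, IsPos y → y + 1 ≠ 0 := by
    intro y hy h0
    rw [eq_neg_of_add_eq_zero_left h0] at hy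
    exact isPos_one.not_isPos_neg hq hy
  rcases isPos_or_isPos_neg hq hx0 with hx | hx
  · have hiff := isPos_neg_pow_add_one_iff hq h hx
    rcases isPos_or_isPos_neg hq (hne x hx) with h1 | h1
    · have h2 := (isPos_or_isPos_neg hq (hne _ (hx.pow n))).resolve_right
        fun h2 => h1.not_isPos_neg hq (hiff.1 h2)
      rw [h1.pow_card_div_two hq, h2.pow_card_div_two hq]
    · rw [pow_card_div_two_of_isPos_neg hq h1, pow_card_div_two_of_isPos_neg hq (hiff.2 h1)]
  · obtain ⟨y, rfl⟩ : ∃ y, x = -y := ⟨-x, (neg_neg x).symm⟩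
    rw [neg_neg] at hx
    rw [hodd.neg_pow, neg_add_eq_sub, neg_add_eq_sub]
    rcases eq_or_ne y 1 with rfl | hy
    · rw [one_pow]
    rcases isPos_or_isPos_neg hq (sub_ne_zero.2 hy.symm) with h1 | h1
    · rw [h1.pow_card_div_two hq, (isPos_one_sub_pow h hx h1).pow_card_div_two hq]
    · have h2 := isPos_pow_sub_one h (by rwa [neg_sub] at h1)
      rw [← neg_sub] at h2
      rw [pow_card_div_two_of_isPos_neg hq h1, pow_card_div_two_of_isPos_neg hq h2]

open Polynomial in
/-- If `x ↦ x ^ n` permutes the exponents modulo `|F| - 1` and respects the polynomial function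
`(x + 1) ^ m`, then it respects the binomial coefficients of `m` in `F`. -/
theorem cast_choose_mul_mod_eq {n m : ℕ} (hcop : n.Coprime (Fintype.card F - 1))
    (hm : m < Fintype.card F - 1) (h : ∀ x : F, (x ^ n + 1) ^ m = (x + 1) ^ m) {j : ℕ}
    (hj : j ≤ m) :
    (m.choose (n * j % (Fintype.card F - 1)) : F) = m.choose j := by
  classical
  set Q := Fintype.card F - 1 with hQ
  have hinj : ∀ i ≤ m, ∀ j ≤ m, n * i % Q = n * j % Q → i = j := by
    intro i hi j hj hij
    have : i ≡ j [MOD Q] := Nat.ModEq.cancel_left_of_coprime hcop.symm hij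
    exact Nat.ModEq.eq_of_lt_of_lt this (by omega) (by omega)
  let P : F[X] := ∑ i ∈ Finset.range (m + 1), C (m.choose i : F) * X ^ (n * i % Q)
  have hdegP : P.degree < Fintype.card F := by
    refine (Polynomial.degree_sum_le _ _).trans_lt ?_
    rw [Finset.sup_lt_iff (WithBot.bot_lt_coe _)]
    intro i _
    refine (degree_C_mul_X_pow_le _ _).trans_lt ?_
    have := Nat.mod_lt (n * i) (show 0 < Q by omega)
    exact_mod_cast (by omega : n * i % Q < Fintype.card F)
  have hdegR : ((X + 1 : F[X]) ^ m).degree < Fintype.card F := by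
    refine (degree_pow_le _ _).trans_lt ?_
    rw [← C_1, degree_X_add_C, nsmul_one]
    exact_mod_cast (by omega : m < Fintype.card F)
  have heq : P = (X + 1) ^ m := by
    refine Polynomial.eq_of_degrees_lt_of_eval_finset_eq Finset.univ hdegP hdegR ?_
    intro x _
    simp only [P, eval_finsetSum, eval_mul, eval_C, eval_pow, eval_X, eval_add, eval_one]
    rw [← h x, add_pow]
    refine Finset.sum_congr rfl fun i hi => ?_
    rw [one_pow, mul_one, mul_comm, ← pow_mul]
    congr 1
    rcases eq_or_ne x 0 with rfl | hx
    · rcases Nat.eq_zero_or_pos i with rfl | hi0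
      · simp
      · have hi' : i ≤ m := by simpa [Nat.lt_succ_iff] using hi
        have h1 : n * i % Q ≠ 0 := fun h0 =>
          hi0.ne' (hinj i hi' 0 (Nat.zero_le _) (by simpa using h0))
        have h2 : n * i ≠ 0 := fun h0 => h1 (by rw [h0, Nat.zero_mod])
        rw [zero_pow h1, zero_pow h2]
    · conv_rhs => rw [← Nat.mod_add_div (n * i) Q, pow_add, pow_mul,
        FiniteField.pow_card_sub_one_eq_one x hx, one_pow, mul_one]
  have hcoeff := congrArg (fun R : F[X] => R.coeff (n * j % Q)) heq
  simp only [P, finsetSum_coeff, coeff_C_mul, coeff_X_pow, coeff_X_add_one_pow] at hcoeff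
  rw [← hcoeff, Finset.sum_eq_single j]
  · simp
  · intro i hi hij
    have hi' : i ≤ m := by simpa [Nat.lt_succ_iff] using hi
    rw [if_neg fun h0 => hij (hinj j hj i hi' h0).symm, mul_zero]
  · intro h0
    exact absurd (Finset.mem_range.2 (Nat.lt_succ_of_le hj)) h0

end QuadraticCharacter

section Digits

theorem sum_mul_pow_succ (p k : ℕ) (d : ℕ → ℕ) :
    ∑ i ∈ Finset.range (k + 1), d i * p ^ i =
      d 0 + p * ∑ i ∈ Finset.range k, d (i + 1) * p ^ i := by
  rw [Finset.sum_range_succ', Finset.mul_sum, add_comm]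
  simp only [pow_zero, mul_one]
  congr 1
  refine Finset.sum_congr rfl fun i _ => ?_
  ring

theorem sum_mul_pow_digits_injective {p : ℕ} (k : ℕ) (d e : ℕ → ℕ) (hd : ∀ i < k, d i < p)
    (he : ∀ i < k, e i < p)
    (h : ∑ i ∈ Finset.range k, d i * p ^ i = ∑ i ∈ Finset.range k, e i * p ^ i) :
    ∀ i < k, d i = e i := by
  induction k generalizing d e with
  | zero => simp
  | succ k ih =>
    rw [sum_mul_pow_succ, sum_mul_pow_succ] at h
    have hd0 := hd 0 (Nat.succ_pos k)
    have he0 := he 0 (Nat.succ_pos k)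
    have h0 : d 0 = e 0 := by
      have := congrArg (· % p) h
      simpa [Nat.add_mul_mod_self_left, Nat.mod_eq_of_lt hd0, Nat.mod_eq_of_lt he0] using this
    rw [h0, Nat.add_left_cancel_iff] at h
    have h1 := ih (fun i => d (i + 1)) (fun i => e (i + 1)) (fun i hi => hd _ (by omega))
      (fun i hi => he _ (by omega)) (Nat.eq_of_mul_eq_mul_left (by omega) h)
    rintro (_ | i) hi
    · exact h0
    · exact h1 i (by omega)

/-- Lucas' theorem for the binomial coefficients of a repdigit. -/
theorem not_dvd_choose_repdigit_iff {p : ℕ} (hp : p.Prime) {c : ℕ} (hc : c < p) (k t : ℕ) :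
    ¬ p ∣ (∑ i ∈ Finset.range k, c * p ^ i).choose t ↔
      ∃ d : ℕ → ℕ, (∀ i, d i ≤ c) ∧ t = ∑ i ∈ Finset.range k, d i * p ^ i := by
  have : Fact p.Prime := ⟨hp⟩
  induction k generalizing t with
  | zero =>
    rcases Nat.eq_zero_or_pos t with rfl | ht
    · simp only [Finset.range_zero, Finset.sum_empty, Nat.choose_self, Nat.dvd_one, hp.ne_one,
        not_false_eq_true, and_true, true_iff]
      exact ⟨fun _ => 0, fun _ => Nat.zero_le _⟩
    · simp [Nat.choose_eq_zero_of_lt ht, ht.ne']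
  | succ k ih =>
    have hdig : ∀ r ≤ c, ¬ p ∣ c.choose r := by
      intro r hr hdvd
      have h1 : p ∣ c.factorial := by
        rw [← Nat.choose_mul_factorial_mul_factorial hr, mul_assoc]
        exact hdvd.mul_right _
      exact absurd ((hp.dvd_factorial).1 h1) (by omega)
    have hstep : ∀ t, ¬ p ∣ (∑ i ∈ Finset.range (k + 1), c * p ^ i).choose t ↔
        t % p ≤ c ∧ ∃ d : ℕ → ℕ, (∀ i, d i ≤ c) ∧
          t / p = ∑ i ∈ Finset.range k, d i * p ^ i := by
      intro t
      have hl := Choose.choose_modEq_choose_mod_mul_choose_div_nat (p := p)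
        (n := ∑ i ∈ Finset.range (k + 1), c * p ^ i) (k := t)
      rw [hl.dvd_iff dvd_rfl, hp.dvd_mul, not_or,
        sum_mul_pow_succ p k (fun _ => c), Nat.add_mul_mod_self_left, Nat.mod_eq_of_lt hc,
        Nat.add_mul_div_left _ _ hp.pos, Nat.div_eq_of_lt hc, zero_add]
      refine and_congr ⟨fun h => ?_, hdig _⟩ (ih (t / p))
      by_contra! hlt
      exact h (by rw [Nat.choose_eq_zero_of_lt hlt]; exact dvd_zero p)
    rw [hstep]
    constructor
    · rintro ⟨h0, d, hd, ht⟩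
      refine ⟨fun i => Nat.casesOn i (t % p) d, fun i => by cases i <;> simp [h0, hd], ?_⟩
      rw [sum_mul_pow_succ, ← ht]
      exact (Nat.mod_add_div t p).symm
    · rintro ⟨d, hd, rfl⟩
      have hd0 := (hd 0).trans_lt hc
      rw [sum_mul_pow_succ, Nat.add_mul_mod_self_left, Nat.mod_eq_of_lt hd0,
        Nat.add_mul_div_left _ _ hp.pos, Nat.div_eq_of_lt hd0, zero_add]
      exact ⟨hd 0, fun i => d (i + 1), fun i => hd _, rfl⟩

theorem two_mul_sum_mul_pow (c k : ℕ) :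
    2 * ∑ i ∈ Finset.range k, c * (2 * c + 1) ^ i + 1 = (2 * c + 1) ^ k := by
  induction k with
  | zero => simp
  | succ k ih =>
    rw [Finset.sum_range_succ, pow_succ, mul_add, ← ih]
    ring

/-- If multiplication by `n` modulo `p ^ k - 1` maps the numbers with base-`p` digits at most
`c = (p - 1) / 2` to each other, then `n` is a power of `p` modulo `p ^ k - 1`. -/
theorem exists_modEq_pow_of_small_digits {p c k n : ℕ} (hpc : p = 2 * c + 1) (hc : 0 < c)
    (hk : 0 < k) (hcop : n.Coprime (p ^ k - 1))
    (h : ∀ d : ℕ → ℕ, (∀ i, d i ≤ c) → ∃ e : ℕ → ℕ, (∀ i, e i ≤ c) ∧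
      ∑ i ∈ Finset.range k, e i * p ^ i ≡ n * ∑ i ∈ Finset.range k, d i * p ^ i
        [MOD p ^ k - 1]) :
    ∃ i < k, n ≡ p ^ i [MOD p ^ k - 1] := by
  set N : (ℕ → ℕ) → ℕ := fun d => ∑ i ∈ Finset.range k, d i * p ^ i with hN
  have hNadd : ∀ d e : ℕ → ℕ, N (d + e) = N d + N e := by
    intro d e
    simp only [hN, Pi.add_apply, add_mul, Finset.sum_add_distrib]
  have hrep : 2 * N (fun _ => c) + 1 = p ^ k := by
    simp only [hN]
    rw [hpc]
    exact two_mul_sum_mul_pow c k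
  have hNmono : ∀ d e : ℕ → ℕ, (∀ i < k, d i ≤ e i) → N d ≤ N e := fun d e hde =>
    Finset.sum_le_sum fun i hi => Nat.mul_le_mul_right _ (hde i (Finset.mem_range.1 hi))
  have hNpos : ∀ d : ℕ → ℕ, (∃ i < k, d i ≠ 0) → 0 < N d := by
    rintro d ⟨i, hi, hdi⟩
    have h1 : d i * p ^ i ≤ N d := Finset.single_le_sum
      (f := fun i => d i * p ^ i) (fun _ _ => Nat.zero_le _) (Finset.mem_range.2 hi)
    have h2 : 0 < d i * p ^ i := Nat.mul_pos (Nat.pos_of_ne_zero hdi) (Nat.pow_pos (by omega))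
    omega
  have hcpos : 0 < N fun _ => c := hNpos _ ⟨0, hk, hc.ne'⟩
  have hNsingle : ∀ b < k, N (Pi.single b 1) = p ^ b := by
    intro b hb
    simp only [hN]
    rw [Finset.sum_eq_single b]
    · simp
    · intro i _ hib
      simp [hib]
    · intro h0
      exact absurd (Finset.mem_range.2 hb) h0
  have hnz : ∀ d : ℕ → ℕ, (∀ i < k, d i ≤ c) → 0 < N d → ¬ n * N d ≡ 0 [MOD p ^ k - 1] := by
    intro d hd hd0 hmod
    have h1 : p ^ k - 1 ∣ N d :=
      hcop.symm.dvd_of_dvd_mul_left ((Nat.modEq_zero_iff_dvd).1 hmod)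
    have h2 := Nat.le_of_dvd hd0 h1
    have h3 := hNmono d (fun _ => c) hd
    omega
  have hE : ∀ b : ℕ, ∃ e : ℕ → ℕ, (∀ i, e i ≤ c) ∧ (b < k → N e ≡ n * p ^ b [MOD p ^ k - 1]) := by
    intro b
    obtain ⟨e, he, hmod⟩ := h (Pi.single b 1) (fun i => by
      rcases eq_or_ne i b with rfl | hib
      · simpa using Nat.one_le_of_lt hc
      · simp [hib])
    exact ⟨e, he, fun hb => by rw [← hNsingle b hb]; exact hmod⟩
  choose E hEc hEmod using hE
  set S : (ℕ → ℕ) → ℕ → ℕ := fun d i => ∑ b ∈ Finset.range k, d b * E b i with hS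
  have hSadd : ∀ d b, b < k → S (d + Pi.single b 1) = S d + E b := by
    intro d b hb
    funext i
    simp only [hS, Pi.add_apply, add_mul, Finset.sum_add_distrib]
    congr 1
    rw [Finset.sum_eq_single b]
    · simp
    · intro j _ hjb
      simp [hjb]
    · intro h0
      exact absurd (Finset.mem_range.2 hb) h0
  -- There are no carries: the digits of the image are the `S d i`, and they stay at most `c`.
  have main : ∀ r : ℕ, ∀ d : ℕ → ℕ, (∀ i, d i ≤ c) → ∑ i ∈ Finset.range k, d i = r →
      (∀ i < k, S d i ≤ c) ∧ N (S d) ≡ n * N d [MOD p ^ k - 1] := by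
    intro r
    induction r with
    | zero =>
      intro d _ hsum
      have hd0 : ∀ i ∈ Finset.range k, d i = 0 := Finset.sum_eq_zero_iff.1 hsum
      have h1 : S d = 0 := by
        funext i
        exact Finset.sum_eq_zero fun b hb => by rw [hd0 b hb, zero_mul]
      have h2 : N d = 0 := Finset.sum_eq_zero fun b hb => by rw [hd0 b hb, zero_mul]
      have h3 : N 0 = 0 := Finset.sum_eq_zero fun b _ => by simp
      rw [h1, h2, h3]
      exact ⟨fun i _ => Nat.zero_le _, Nat.ModEq.refl _⟩
    | succ r ih =>
      intro d hd hsum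
      obtain ⟨b, hb, hdb⟩ : ∃ b ∈ Finset.range k, d b ≠ 0 := by
        by_contra! hcon
        rw [Finset.sum_eq_zero hcon] at hsum
        omega
      have hbk := Finset.mem_range.1 hb
      obtain ⟨d', rfl⟩ : ∃ d' : ℕ → ℕ, d = d' + Pi.single b 1 := by
        refine ⟨fun i => d i - (Pi.single b 1 : ℕ → ℕ) i, ?_⟩
        funext i
        change d i = d i - (Pi.single b 1 : ℕ → ℕ) i + (Pi.single b 1 : ℕ → ℕ) i
        rcases eq_or_ne i b with rfl | hib
        · rw [Pi.single_eq_same]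
          omega
        · rw [Pi.single_eq_of_ne hib, Nat.sub_zero, Nat.add_zero]
      have hd' : ∀ i, d' i ≤ c := fun i => (Nat.le_add_right _ _).trans (hd i)
      have hsum' : ∑ i ∈ Finset.range k, d' i = r := by
        simp only [Pi.add_apply, Finset.sum_add_distrib] at hsum
        have hone : ∑ i ∈ Finset.range k, Pi.single b 1 i = 1 := by
          rw [Finset.sum_eq_single_of_mem b hb fun i _ hib => Pi.single_eq_of_ne hib 1,
            Pi.single_eq_same]
        omega
      obtain ⟨hle, hmod⟩ := ih d' hd' hsum'
      have hmod' : N (S (d' + Pi.single b 1)) ≡ n * N (d' + Pi.single b 1) [MOD p ^ k - 1] := by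
        rw [hSadd _ _ hbk, hNadd, hNadd, mul_add, hNsingle b hbk]
        exact hmod.add (hEmod b hbk)
      refine ⟨?_, hmod'⟩
      have hlt : ∀ i < k, S (d' + Pi.single b 1) i ≤ c + c := by
        intro i hi
        rw [hSadd _ _ hbk]
        exact Nat.add_le_add (hle i hi) (hEc b i)
      obtain ⟨e, he, hemod⟩ := h _ hd
      have hne := hnz _ (fun i _ => hd i) (hNpos _ ⟨b, hbk, hdb⟩)
      have hcong : N e ≡ N (S (d' + Pi.single b 1)) [MOD p ^ k - 1] := hemod.trans hmod'.symm
      have hNe := hNmono e (fun _ => c) fun i _ => he i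
      have hNS : N (S (d' + Pi.single b 1)) ≤ p ^ k - 1 := by
        have h1 := hNmono _ ((fun _ => c) + fun _ => c) hlt
        rw [hNadd] at h1
        omega
      have hNS' : N (S (d' + Pi.single b 1)) ≠ p ^ k - 1 := by
        intro h0
        rw [h0] at hmod'
        exact hne (hmod'.symm.trans (Nat.modEq_zero_iff_dvd.2 dvd_rfl))
      have heq := Nat.ModEq.eq_of_lt_of_lt hcong (by omega) (by omega)
      have hdig := sum_mul_pow_digits_injective k e (S (d' + Pi.single b 1))
        (fun i _ => (he i).trans_lt (by omega)) (fun i hi => (hlt i hi).trans_lt (by omega)) heq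
      intro i hi
      rw [← hdig i hi]
      exact he i
  have hcol : ∀ i ∈ Finset.range k, ∑ b ∈ Finset.range k, E b i ≤ 1 := by
    intro i hi
    have h1 := (main _ (fun _ => c) (fun _ => le_rfl) rfl).1 i (Finset.mem_range.1 hi)
    simp only [hS] at h1
    rw [← Finset.mul_sum] at h1
    exact Nat.le_of_mul_le_mul_left (by omega) hc
  have hrow : ∀ b ∈ Finset.range k, 1 ≤ ∑ i ∈ Finset.range k, E b i := by
    intro b hb
    have hbk := Finset.mem_range.1 hb
    by_contra! hcon
    have h1 : ∀ i ∈ Finset.range k, E b i = 0 := Finset.sum_eq_zero_iff.1 (by omega)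
    have h2 : N (E b) = 0 := Finset.sum_eq_zero fun i hi => by rw [h1 i hi, zero_mul]
    have h3 := hEmod b hbk
    rw [h2] at h3
    refine hnz (Pi.single b 1) (fun i _ => ?_) ?_ (by rw [hNsingle b hbk]; exact h3.symm)
    · rcases eq_or_ne i b with rfl | hib
      · simpa using Nat.one_le_of_lt hc
      · simp [hib]
    · rw [hNsingle b hbk]
      exact Nat.pow_pos (by omega)
  have hrow0 : ∑ i ∈ Finset.range k, E 0 i = 1 := by
    have h1 : ∑ b ∈ Finset.range k, ∑ i ∈ Finset.range k, E b i ≤ k := by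
      rw [Finset.sum_comm]
      simpa using Finset.sum_le_sum hcol
    have h2 : ∑ b ∈ Finset.range k, 1 = ∑ b ∈ Finset.range k, ∑ i ∈ Finset.range k, E b i :=
      le_antisymm (Finset.sum_le_sum hrow) (by simpa using h1)
    exact ((Finset.sum_eq_sum_iff_of_le hrow).1 h2 0 (Finset.mem_range.2 hk)).symm
  obtain ⟨i, hi, hEi⟩ : ∃ i ∈ Finset.range k, E 0 i ≠ 0 := by
    by_contra! hcon
    rw [Finset.sum_eq_zero hcon] at hrow0
    omega
  have hik := Finset.mem_range.1 hi
  have hsplit := Finset.add_sum_erase _ (E 0) hi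
  rw [hrow0] at hsplit
  have hrest : ∀ j ∈ (Finset.range k).erase i, E 0 j = 0 := Finset.sum_eq_zero_iff.1 (by omega)
  have hNE : N (E 0) = p ^ i := by
    simp only [hN]
    rw [Finset.sum_eq_single i]
    · rw [show E 0 i = 1 by omega, one_mul]
    · intro j hj hji
      rw [hrest j (Finset.mem_erase.2 ⟨hji, hj⟩), zero_mul]
    · intro h0
      exact absurd hi h0
  refine ⟨i, hik, ?_⟩
  have h1 := hEmod 0 hk
  rw [hNE, pow_zero, mul_one] at h1
  exact h1.symm

end Digits

/-- over `F = 𝔽_{p^k}` with `q ≡ 3 (mod 4)` and `1 ≤ n ≤ q − 1`, the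
monomial `x ↦ x^n` preserves positivity on `M_2(F)` iff `n = p^i` for some
`0 ≤ i ≤ k − 1`. -/
theorem stmt19 {F : Type*} [Field F] [Fintype F] (p k : ℕ) (hp : p.Prime)
    (hcard : Fintype.card F = p ^ k) (hq : Fintype.card F % 4 = 3) (n : ℕ)
    (hn1 : 1 ≤ n) (hn2 : n ≤ Fintype.card F - 1) :
    PreservesPos 2 (fun x : F => x ^ n) ↔
      ∃ i : ℕ, i ≤ k - 1 ∧ n = p ^ i := by
  have : Fact p.Prime := ⟨hp⟩
  have : CharP F p := charP_of_card_eq_prime_pow hcard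
  constructor
  · intro hpres
    have hs : ∀ s : F, IsPos s → IsPos ((1 + s) ^ n - 1) :=
      fun s hs => hpres.isPos_one_add_pow_sub_one hs
    have hodd := odd_of_isPos_one_add_pow_sub_one hq hs
    have hcop := coprime_card_sub_one hq hs
    have hk : 0 < k := by
      rcases Nat.eq_zero_or_pos k with rfl | hk
      · rw [hcard, pow_zero] at hq
        omega
      · exact hk
    have hpodd : Odd p := by
      have h1 : Odd (p ^ k) := hcard ▸ Nat.odd_iff.2 (by omega)
      exact (Nat.odd_pow_iff hk.ne').1 h1
    obtain ⟨c, hpc⟩ := hpodd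
    have hc : 0 < c := by
      have := hp.two_le
      omega
    have hrep : ∑ i ∈ Finset.range k, c * p ^ i = Fintype.card F / 2 := by
      have h1 := two_mul_sum_mul_pow c k
      rw [← hpc, ← hcard] at h1
      omega
    obtain ⟨i, hik, hi⟩ := exists_modEq_pow_of_small_digits hpc hc hk (hcard ▸ hcop) (by
      intro d hd
      have hle : ∑ i ∈ Finset.range k, d i * p ^ i ≤ Fintype.card F / 2 := by
        rw [← hrep]
        exact Finset.sum_le_sum fun i _ => Nat.mul_le_mul_right _ (hd i)
      have h1 := (not_dvd_choose_repdigit_iff hp (by omega : c < p) k _).2 ⟨d, hd, rfl⟩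
      rw [hrep, ← CharP.cast_eq_zero_iff F p, ← cast_choose_mul_mod_eq hcop (by omega)
        (pow_add_one_pow_card_div_two hq hs) hle, CharP.cast_eq_zero_iff F p, ← hrep] at h1
      obtain ⟨e, he, het⟩ := (not_dvd_choose_repdigit_iff hp (by omega : c < p) k _).1 h1
      refine ⟨e, he, ?_⟩
      rw [← het, hcard]
      exact Nat.mod_modEq _ _)
    refine ⟨i, by omega, ?_⟩
    have h1 : p ^ i * p ≤ p ^ k := by
      rw [← pow_succ]
      exact Nat.pow_le_pow_right hp.pos hik
    have h2 : p ^ i * 3 ≤ p ^ i * p := Nat.mul_le_mul_left _ (by omega)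
    have h3 : 0 < p ^ i := Nat.pow_pos hp.pos
    have h4 := Nat.odd_iff.1 hodd
    exact Nat.ModEq.eq_of_lt_of_lt hi (by omega) (by omega)
  · rintro ⟨i, _, rfl⟩
    exact preservesPos_two_pow_expChar_pow p i
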